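/- Let A be a finite set of m ≥ 3 alternatives, 0 ≤ ε < ε′ < 1 and 0 < δ < 1/2, and set ℓ = ⌈(64/(ε′−ε)²)·((m(m−1)/2 + 1)·m·ln m + ln(1/δ))⌉. Define f on ℓ-tuples of preferences over A by f(S) = 1 iff one can delete at most (ε+ε′)ℓ/2 of the ℓ preferences of S so that the remaining preferences form a single-crossing profile. Then for every fixed profile P of n preferences over A: if there is a set of at most εn preferences of P whose deletion leaves a single-crossing profile, then the probability over sampling that f applied to an ℓ-sample from P equals 1 is at least 1−δ; and if deleting any ε′n preferences of P leaves a profile that is not single-crossing, then the probability that f applied to an ℓ-sample from P equals 0 is at least 1−δ. -/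

import Mathlib

/-- A strict linear order on `A`, encoded as a Boolean relation. -/
def IsLinOrd {A : Type*} (r : A → A → Bool) : Prop :=
  (∀ a, ¬ r a a) ∧ (∀ a b c, r a b → r b c → r a c) ∧ (∀ a b, a ≠ b → r a b ∨ r b a)

instance IsLinOrd.decPred {A : Type*} [Fintype A] [DecidableEq A] :
    DecidablePred (@IsLinOrd A) := fun r => by
  unfold IsLinOrd; infer_instance

/-- A preference: a strict linear order on the set `A` of alternatives. -/
abbrev Pref (A : Type*) := {r : A → A → Bool // IsLinOrd r}

/-- Restriction of a preference to a subset `X` of the alternatives. -/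
def Pref.restrict {A : Type*} (r : Pref A) (X : Finset A) : Pref {a // a ∈ X} :=
  ⟨fun u v => r.1 u.1 v.1, by
    obtain ⟨h1, h2, h3⟩ := r.2
    exact ⟨fun u => h1 u.1, fun u v w => h2 u.1 v.1 w.1,
      fun u v huv => h3 u.1 v.1 (fun h => huv (Subtype.ext h))⟩⟩

/-- `r` is single-peaked with respect to the societal axis `ax`. -/
def SinglePeakedWrt {A : Type*} (ax r : Pref A) : Prop :=
  ∀ t : A, (∀ z, z ≠ t → r.1 t z) → ∀ u v : A,
    (((ax.1 t u ∧ ax.1 u v) ∨ (ax.1 v u ∧ ax.1 u t)) ∨ (u = t ∧ v ≠ t)) → r.1 u v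

/-- A profile is single-peaked if there is a single axis w.r.t. which every preference
of the profile is single-peaked. -/
def IsSinglePeaked {A ι : Type*} (P : ι → Pref A) : Prop :=
  ∃ ax : Pref A, ∀ i, SinglePeakedWrt ax (P i)

/-- A profile (in its given order) is single-crossing: for each ordered pair of
alternatives, the relative order changes at most once along the sequence. -/
def SingleCrossingInOrder {A : Type*} {n : ℕ} (P : Fin n → Pref A) : Prop :=
  ∀ a b : A, ∀ i j k : Fin n, i ≤ j → j ≤ k → (P i).1 a b → (P k).1 a b → (P j).1 a b

/-- A profile is single-crossing if some reordering of its preferences is single-crossing. -/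
def IsSingleCrossing {A ι : Type*} [Fintype ι] (P : ι → Pref A) : Prop :=
  ∃ e : Fin (Fintype.card ι) ≃ ι, SingleCrossingInOrder (fun i => P (e i))

/-- Probability of an event under the uniform distribution on a finite sample space. -/
noncomputable def pr {Ω : Type*} [Fintype Ω] (E : Ω → Prop) : ℝ :=
  haveI := Classical.decPred E
  ((Finset.univ.filter E).card : ℝ) / (Fintype.card Ω : ℝ)

/-- Number of occurrences of the order `q` in the tuple `S` of preferences. -/
noncomputable def countPref {A : Type*} {ℓ : ℕ} (S : Fin ℓ → Pref A) (q : Pref A) : ℕ :=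
  haveI : DecidableEq (Pref A) := Classical.decEq _
  (Finset.univ.filter (fun j => S j = q)).card

/-- Preference-distance of a profile from a domain `D`: `n` minus the maximum size of
an index set whose subprofile lies in a single member of `D`. -/
noncomputable def prefDist {A : Type*} {n : ℕ} (D : Finset (Finset (Pref A)))
    (P : Fin n → Pref A) : ℕ :=
  haveI := Classical.decPred (fun J : Finset (Fin n) => ∃ S ∈ D, ∀ i ∈ J, P i ∈ S)
  n - ((Finset.univ : Finset (Finset (Fin n))).filter
        (fun J => ∃ S ∈ D, ∀ i ∈ J, P i ∈ S)).sup Finset.card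

section UniformProbability

variable {Ω : Type*} [Fintype Ω]

lemma pr_mono {E F : Ω → Prop} (h : ∀ ω, E ω → F ω) : pr E ≤ pr F := by
  classical
  unfold pr
  gcongr with ω
  exact h ω

lemma pr_eq_zero {E : Ω → Prop} (h : ∀ ω, ¬ E ω) : pr E = 0 := by
  simp [pr, h]

lemma pr_add_pr_not [Nonempty Ω] (E : Ω → Prop) : pr E + pr (fun ω => ¬ E ω) = 1 := by
  classical
  unfold pr
  rw [← add_div, div_eq_one_iff_eq (by simp)]
  norm_cast
  rw [← Finset.card_univ]
  convert Finset.card_filter_add_card_filter_not (s := (Finset.univ : Finset Ω)) E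

lemma pr_exists_le {G : Type*} [Fintype G] (E : G → Ω → Prop) {c : ℝ}
    (h : ∀ g, pr (E g) ≤ c) : pr (fun ω => ∃ g, E g ω) ≤ Fintype.card G * c := by
  classical
  calc pr (fun ω => ∃ g, E g ω) ≤ ∑ g, pr (E g) := by
        unfold pr
        rw [← Finset.sum_div]
        gcongr
        norm_cast
        refine le_trans (Finset.card_le_card ?_) Finset.card_biUnion_le
        intro ω hω
        simpa using hω
    _ ≤ ∑ _g : G, c := Finset.sum_le_sum fun g _ => h g
    _ = Fintype.card G * c := by simp

end UniformProbability

/-- Chernoff bound for the number of hits of a set in a uniform sample with replacement. -/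
lemma pr_card_filter_mem_ge_le {n ℓ : ℕ} (hn : 1 ≤ n) (T : Finset (Fin n)) {p d : ℝ}
    (hT : (T.card : ℝ) ≤ p * n) (hp : p ≤ 1) (hd0 : 0 ≤ d) (hd1 : d ≤ 1) :
    pr (fun σ : Fin ℓ → Fin n =>
      (p + d) * ℓ ≤ ((Finset.univ.filter fun j => σ j ∈ T).card : ℝ)) ≤
      Real.exp (-(ℓ * d ^ 2 / 4)) := by
  classical
  have hn0 : (0 : ℝ) < n := by exact_mod_cast hn
  set s : ℝ := d / 2 with hs
  have hexp : Real.exp s ≤ 1 + s + s ^ 2 := by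
    have := abs_le.1 (Real.abs_exp_sub_one_sub_id_le (x := s) (by rw [abs_le]; constructor <;> linarith))
    linarith [this.2]
  have hs0 : 0 ≤ s := by positivity
  have hmgf : ∑ σ : Fin ℓ → Fin n,
      Real.exp (s * ((Finset.univ.filter fun j => σ j ∈ T).card : ℝ)) =
      (n + T.card * (Real.exp s - 1)) ^ ℓ := by
    have h1 : ∀ σ : Fin ℓ → Fin n,
        Real.exp (s * ((Finset.univ.filter fun j => σ j ∈ T).card : ℝ)) =
        ∏ j, (if σ j ∈ T then Real.exp s else 1) := by
      intro σ
      rw [Finset.prod_ite, Finset.prod_const, Finset.prod_const_one, mul_one, ← Real.exp_nat_mul,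
        mul_comm]
    have h2 : ∑ i : Fin n, (if i ∈ T then Real.exp s else 1) =
        n + T.card * (Real.exp s - 1) := by
      have h3 : ∀ i : Fin n, (if i ∈ T then Real.exp s else 1) =
          1 + (if i ∈ T then Real.exp s - 1 else 0) := by
        intro i; split_ifs <;> ring
      simp only [h3, Finset.sum_add_distrib]
      simp [mul_sub]
    simp only [h1]
    rw [← h2, Finset.sum_pow', Fintype.piFinset_univ]
  have hbase : (n : ℝ) + T.card * (Real.exp s - 1) ≤ n * Real.exp (p * s + s ^ 2) := by
    have h1 : (T.card : ℝ) * (Real.exp s - 1) ≤ (p * n) * (s + s ^ 2) :=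
      mul_le_mul hT (by linarith) (by linarith [Real.one_le_exp hs0])
        (le_trans (Nat.cast_nonneg _) hT)
    have h2 := Real.add_one_le_exp (p * s + s ^ 2)
    have h3 : (n : ℝ) * (p * s ^ 2) ≤ n * s ^ 2 := by
      gcongr; nlinarith [sq_nonneg s]
    nlinarith
  have hmarkov : ((Finset.univ.filter fun σ : Fin ℓ → Fin n =>
        (p + d) * ℓ ≤ ((Finset.univ.filter fun j => σ j ∈ T).card : ℝ)).card : ℝ) *
      Real.exp (s * ((p + d) * ℓ)) ≤ (n + T.card * (Real.exp s - 1)) ^ ℓ := by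
    rw [← hmgf, ← nsmul_eq_mul, ← Finset.sum_const]
    refine le_trans (Finset.sum_le_sum fun σ hσ => ?_)
      (Finset.sum_le_sum_of_subset_of_nonneg (Finset.filter_subset _ _)
        fun _ _ _ => (Real.exp_pos _).le)
    have := (Finset.mem_filter.1 hσ).2
    gcongr
  have hpow : (n + T.card * (Real.exp s - 1)) ^ ℓ ≤
      (n : ℝ) ^ ℓ * Real.exp (ℓ * (p * s + s ^ 2)) := by
    rw [Real.exp_nat_mul, ← mul_pow]
    refine pow_le_pow_left₀ ?_ hbase ℓ
    have := Real.one_le_exp hs0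
    have : 0 ≤ (T.card : ℝ) * (Real.exp s - 1) := by
      apply mul_nonneg (Nat.cast_nonneg _); linarith
    linarith
  unfold pr
  rw [div_le_iff₀ (by
    rw [Nat.cast_pos, Fintype.card_pos_iff]
    exact ⟨fun _ => ⟨0, hn⟩⟩)]
  have hcard : (Fintype.card (Fin ℓ → Fin n) : ℝ) = (n : ℝ) ^ ℓ := by simp
  rw [hcard]
  have hsplit : (n : ℝ) ^ ℓ * Real.exp (ℓ * (p * s + s ^ 2)) =
      (Real.exp (-(ℓ * d ^ 2 / 4)) * (n : ℝ) ^ ℓ) * Real.exp (s * ((p + d) * ℓ)) := by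
    rw [mul_comm (Real.exp _), mul_assoc, ← Real.exp_add]
    congr 2
    rw [hs]; ring
  refine le_of_mul_le_mul_right ?_ (Real.exp_pos (s * ((p + d) * ℓ)))
  rw [← hsplit]
  convert hmarkov.trans hpow

section Preferences

variable {A : Type*}

lemma Pref.not_of_apply (r : Pref A) {a b : A} (h : r.1 a b) : ¬ r.1 b a :=
  fun h' => r.2.1 a (r.2.2.1 a b a h h')

lemma Pref.ext_of_imp {r q : Pref A} (h : ∀ a b, r.1 a b → q.1 a b) : r = q := by
  refine Subtype.ext (funext fun a => funext fun b => ?_)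
  rw [Bool.eq_iff_iff]
  refine ⟨h a b, fun hq => ?_⟩
  have hab : a ≠ b := by rintro rfl; exact q.2.1 a hq
  exact (r.2.2.2 a b hab).resolve_right fun hr => q.not_of_apply hq (h b a hr)

lemma Pref.card_le [Fintype A] [DecidableEq A] :
    Fintype.card (Pref A) ≤ Fintype.card A ^ Fintype.card A := by
  let rank : Pref A → A → ℕ := fun r a => (Finset.univ.filter fun c => r.1 a c = true).card
  have hlt : ∀ r a, rank r a < Fintype.card A := fun r a =>
    Finset.card_lt_univ_of_notMem (x := a) (by simpa using r.2.1 a)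
  have hrank : ∀ (r : Pref A) a b, r.1 a b → rank r b < rank r a := by
    intro r a b hab
    refine Finset.card_lt_card (Finset.ssubset_iff_subset_ne.2 ⟨fun c hc => ?_, fun he => ?_⟩)
    · simp only [Finset.mem_filter, Finset.mem_univ, true_and] at hc ⊢
      exact r.2.2.1 a b c hab hc
    · have : b ∈ Finset.univ.filter fun c => r.1 b c = true := by rw [he]; simpa using hab
      exact r.2.1 b (Finset.mem_filter.1 this).2
  have hinj : Function.Injective
      (fun (r : Pref A) (a : A) => (⟨rank r a, hlt r a⟩ : Fin (Fintype.card A))) := by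
    intro r q hrq
    have heq : ∀ a, rank r a = rank q a := fun a => congrArg Fin.val (congrFun hrq a)
    refine Pref.ext_of_imp fun a b hab => ?_
    have hne : a ≠ b := by rintro rfl; exact r.2.1 a hab
    refine (q.2.2.2 a b hne).resolve_right fun hba => ?_
    have h1 := hrank r a b hab
    have h2 := hrank q b a hba
    rw [heq a, heq b] at h1
    omega
  simpa using Fintype.card_le_of_injective _ hinj

/-- Single-crossingness passes to profiles all of whose preferences occur in the given one. -/
lemma IsSingleCrossing.of_range_subset {ι κ : Type*} [Fintype ι] [Fintype κ]
    {P : ι → Pref A} {Q : κ → Pref A} (hP : IsSingleCrossing P)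
    (h : Set.range Q ⊆ Set.range P) : IsSingleCrossing Q := by
  obtain ⟨e, he⟩ := hP
  choose φ hφ using fun k => h ⟨k, rfl⟩
  let e₀ := (Fintype.equivFin κ).symm
  let t : Fin (Fintype.card κ) → Fin (Fintype.card ι) := fun i => e.symm (φ (e₀ i))
  refine ⟨(Tuple.sort t).trans e₀, fun a b i j k hij hjk hi hk => ?_⟩
  have hmono := Tuple.monotone_sort t
  have hQ : ∀ i, Q (((Tuple.sort t).trans e₀) i) = P (e ((t ∘ Tuple.sort t) i)) := by
    intro i
    simp [t, hφ]
  simp only [hQ] at hi hk ⊢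
  exact he a b _ _ _ (hmono hij) (hmono hjk) hi hk

/-- A nonempty single-crossing profile has at most `m * (m - 1) + 1` distinct preferences. -/
lemma IsSingleCrossing.exists_range_eq [Fintype A] [DecidableEq A] {ι : Type*} [Fintype ι]
    [Nonempty ι] {P : ι → Pref A} (hP : IsSingleCrossing P) :
    ∃ g : Fin (Fintype.card A * (Fintype.card A - 1) + 1) → Pref A,
      Set.range g = Set.range P := by
  obtain ⟨e, he⟩ := hP
  let z : Fin (Fintype.card ι) := ⟨0, Fintype.card_pos⟩
  let inv : Pref A → Finset (A × A) := fun r =>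
    Finset.univ.filter fun x => (P (e z)).1 x.1 x.2 = true ∧ r.1 x.2 x.1 = true
  have hmono : ∀ i j, i ≤ j → inv (P (e i)) ⊆ inv (P (e j)) := by
    intro i j hij x hx
    simp only [inv, Finset.mem_filter, Finset.mem_univ, true_and] at hx ⊢
    refine ⟨hx.1, ?_⟩
    have hne : x.2 ≠ x.1 := fun h => by
      have := hx.1
      rw [h] at this
      exact (P (e z)).2.1 _ this
    refine ((P (e j)).2.2.2 _ _ hne).resolve_right fun hj => ?_
    exact Pref.not_of_apply _ hx.2 (he x.1 x.2 z i j (Nat.zero_le _) hij hx.1 hj)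
  have hsub : ∀ r q, inv r = inv q → r = q := by
    intro r q h
    refine Pref.ext_of_imp fun a b hab => ?_
    have hne : a ≠ b := by rintro rfl; exact r.2.1 a hab
    rcases (P (e z)).2.2.2 a b hne with hz | hz
    · refine (q.2.2.2 a b hne).resolve_right fun hq => ?_
      have : (a, b) ∈ inv r := by rw [h]; simp [inv, hz, hq]
      exact r.not_of_apply hab (Finset.mem_filter.1 this).2.2
    · have : (b, a) ∈ inv q := by rw [← h]; simp [inv, hz, hab]
      exact (Finset.mem_filter.1 this).2.2
  have hcard : ∀ r, (inv r).card < Fintype.card A * (Fintype.card A - 1) + 1 := by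
    intro r
    have : inv r ⊆ (Finset.univ : Finset A).offDiag := by
      intro x hx
      have hx := (Finset.mem_filter.1 hx).2.1
      simp only [Finset.mem_offDiag, Finset.mem_univ, true_and]
      intro h
      rw [h] at hx
      exact (P (e z)).2.1 _ hx
    have := Finset.card_le_card this
    rw [Finset.offDiag_card, Finset.card_univ] at this
    rw [Nat.mul_sub_one]
    omega
  let c : Set.range P → Fin (Fintype.card A * (Fintype.card A - 1) + 1) :=
    fun r => ⟨(inv r.1).card, hcard r.1⟩
  have hc : Function.Injective c := by
    rintro ⟨_, i, rfl⟩ ⟨_, j, rfl⟩ h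
    have h : (inv (P i)).card = (inv (P j)).card := congrArg Fin.val h
    refine Subtype.ext (hsub _ _ ?_)
    rw [← e.apply_symm_apply i, ← e.apply_symm_apply j] at h ⊢
    rcases le_total (e.symm i) (e.symm j) with hij | hij
    · exact Finset.eq_of_subset_of_card_le (hmono _ _ hij) h.ge
    · exact (Finset.eq_of_subset_of_card_le (hmono _ _ hij) h.le).symm
  refine ⟨fun x => (Function.invFun c x).1, ?_⟩
  change Set.range (Subtype.val ∘ Function.invFun c) = _
  rw [(Function.invFun_surjective hc).range_comp, Subtype.range_coe]

end Preferences

/-- tester distinguishing profiles that become single-crossing after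
deleting at most `εn` preferences from those needing more than `ε'n` deletions. -/
theorem stmt_10 {A : Type*} [Fintype A] [DecidableEq A] (m : ℕ) (hm : Fintype.card A = m)
    (hm3 : 3 ≤ m)
    (ε ε' δ : ℝ) (hε0 : 0 ≤ ε) (hεε' : ε < ε') (hε'1 : ε' < 1)
    (hδ0 : 0 < δ) (hδ1 : δ < 1/2)
    (ℓ : ℕ)
    (hℓ : ℓ = ⌈(64 / (ε' - ε)^2) *
      (((m : ℝ) * ((m : ℝ) - 1) / 2 + 1) * m * Real.log m + Real.log (1/δ))⌉₊)
    (f : (Fin ℓ → Pref A) → Bool)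
    (hf : ∀ S : Fin ℓ → Pref A, f S = true ↔
      ∃ J : Finset (Fin ℓ), (J.card : ℝ) ≤ (ε + ε') * ℓ / 2 ∧
        IsSingleCrossing (fun i : {i : Fin ℓ // i ∉ J} => S i.1)) :
    ∀ n : ℕ, 1 ≤ n → ∀ P : Fin n → Pref A,
      ((∃ J : Finset (Fin n), (J.card : ℝ) ≤ ε * n ∧
          IsSingleCrossing (fun i : {i : Fin n // i ∉ J} => P i.1)) →
        pr (fun σ : Fin ℓ → Fin n => f (fun j => P (σ j)) = true) ≥ 1 - δ) ∧
      ((∀ J : Finset (Fin n), (J.card : ℝ) ≤ ε' * n →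
          ¬ IsSingleCrossing (fun i : {i : Fin n // i ∉ J} => P i.1)) →
        pr (fun σ : Fin ℓ → Fin n => f (fun j => P (σ j)) = false) ≥ 1 - δ) := by
  intro n hn P
  subst hm
  set m := Fintype.card A
  have hm1 : (3 : ℝ) ≤ m := by exact_mod_cast hm3
  have hlogm : 0 ≤ Real.log m := Real.log_nonneg (by linarith)
  have hlogδ : 0 ≤ Real.log (1 / δ) := Real.log_nonneg (by rw [le_div_iff₀ hδ0]; linarith)
  set L : ℝ := ((m : ℝ) * ((m : ℝ) - 1) / 2 + 1) * m * Real.log m with hL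
  have hL0 : 0 ≤ L := by
    have : (0 : ℝ) ≤ m * (m - 1) := mul_nonneg (by linarith) (by linarith)
    positivity
  set d : ℝ := (ε' - ε) / 2 with hd
  have hd0 : 0 < d := by linarith
  have hd1 : d ≤ 1 := by linarith
  have hδexp : Real.exp (-Real.log (1 / δ)) = δ := by
    rw [one_div, Real.log_inv, neg_neg, Real.exp_log hδ0]
  have hℓd : 4 * (L + Real.log (1 / δ)) ≤ ℓ * d ^ 2 / 4 := by
    have h1 : 64 / (ε' - ε) ^ 2 * (L + Real.log (1 / δ)) ≤ ℓ := hℓ ▸ Nat.le_ceil _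
    have h2 : ε' - ε ≠ 0 := by linarith
    calc 4 * (L + Real.log (1 / δ))
        = (64 / (ε' - ε) ^ 2 * (L + Real.log (1 / δ))) * d ^ 2 / 4 := by
          rw [hd]; field_simp; ring
      _ ≤ ℓ * d ^ 2 / 4 := by gcongr
  have hℓ0 : (0 : ℝ) < ℓ := by
    have hpos : 0 < Real.log (1 / δ) :=
      Real.log_pos (by rw [lt_div_iff₀ hδ0]; linarith)
    by_contra h
    have : (ℓ : ℝ) = 0 := le_antisymm (not_lt.1 h) (Nat.cast_nonneg _)
    rw [this] at hℓd
    linarith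
  have : Nonempty (Fin ℓ → Fin n) := ⟨fun _ => ⟨0, hn⟩⟩
  constructor
  · rintro ⟨J, hJ, hSC⟩
    have htail := pr_card_filter_mem_ge_le (ℓ := ℓ) hn J hJ (by linarith) hd0.le hd1
    have hbad : pr (fun σ : Fin ℓ → Fin n => ¬ f (fun j => P (σ j)) = true) ≤ δ := by
      refine le_trans (pr_mono fun σ hσ => ?_) (htail.trans ?_)
      · by_contra! hlt
        refine hσ ((hf _).2 ⟨Finset.univ.filter fun j => σ j ∈ J, ?_, ?_⟩)
        · refine hlt.le.trans (le_of_eq ?_)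
          rw [hd]; ring
        · refine hSC.of_range_subset ?_
          rintro _ ⟨⟨j, hj⟩, rfl⟩
          exact ⟨⟨σ j, by simpa using hj⟩, rfl⟩
      · rw [← hδexp]
        exact Real.exp_le_exp.2 (by linarith)
    linarith [pr_add_pr_not (fun σ : Fin ℓ → Fin n => f (fun j => P (σ j)) = true)]
  · intro hfar
    classical
    let N := m * (m - 1) + 1
    have htail : ∀ g : Fin N → Pref A, pr (fun σ : Fin ℓ → Fin n => IsSingleCrossing g ∧
        (1 - ε' + d) * ℓ ≤ ((Finset.univ.filter fun j =>
          σ j ∈ Finset.univ.filter fun i => P i ∈ Set.range g).card : ℝ)) ≤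
        Real.exp (-(ℓ * d ^ 2 / 4)) := by
      intro g
      by_cases hg : IsSingleCrossing g
      · refine le_trans (pr_mono fun σ hσ => hσ.2)
          (pr_card_filter_mem_ge_le hn _ ?_ (by linarith) hd0.le hd1)
        by_contra! hlt
        have hsum := Finset.card_filter_add_card_filter_not (s := (Finset.univ : Finset (Fin n)))
          (fun i => P i ∈ Set.range g)
        rw [Finset.card_univ, Fintype.card_fin] at hsum
        have hsum : ((Finset.univ.filter fun i => P i ∈ Set.range g).card : ℝ) +
          ((Finset.univ.filter fun i => ¬ P i ∈ Set.range g).card : ℝ) = n := by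
            exact_mod_cast hsum
        refine hfar (Finset.univ.filter fun i => ¬ P i ∈ Set.range g) (by linarith) ?_
        refine hg.of_range_subset ?_
        rintro _ ⟨⟨i, hi⟩, rfl⟩
        simpa using hi
      · rw [pr_eq_zero fun σ hσ => hg hσ.1]
        positivity
    have hcount : (Fintype.card (Fin N → Pref A) : ℝ) ≤ Real.exp (2 * L) := by
      have h1 : Fintype.card (Fin N → Pref A) ≤ (m ^ m) ^ N := by
        rw [Fintype.card_fun, Fintype.card_fin]
        exact Nat.pow_le_pow_left Pref.card_le N
      have h2 : (((m ^ m) ^ N : ℕ) : ℝ) = Real.exp ((m * N : ℕ) * Real.log m) := by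
        rw [Real.exp_nat_mul, Real.exp_log (by linarith)]
        push_cast
        rw [pow_mul]
      have h3 : ((m * N : ℕ) : ℝ) = m * (m * (m - 1) + 1) := by
        simp only [N]
        push_cast [Nat.cast_sub (show 1 ≤ m by omega)]
        ring
      refine le_trans (Nat.cast_le.2 h1) (h2.trans_le (Real.exp_le_exp.2 ?_))
      rw [h3, hL]
      have : 0 ≤ (m : ℝ) * Real.log m := by positivity
      nlinarith
    have hbad : pr (fun σ : Fin ℓ → Fin n => ¬ f (fun j => P (σ j)) = false) ≤ δ := by
      refine le_trans (pr_mono fun σ hσ => ?_) ((pr_exists_le _ htail).trans ?_)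
      · obtain ⟨J, hJ, hSC⟩ := (hf _).1 (Bool.not_eq_false _ ▸ hσ)
        have hcompl : (Jᶜ.card : ℝ) = ℓ - J.card := by
          rw [eq_sub_iff_add_eq]
          have := Finset.card_compl_add_card J
          rw [Fintype.card_fin] at this
          exact_mod_cast this
        have hlarge : (1 - ε' + d) * ℓ ≤ Jᶜ.card := by
          rw [hcompl, hd]; linarith
        have hne : Jᶜ.Nonempty := by
          rw [← Finset.card_pos]
          have : 0 < (1 - ε' + d) * ℓ := mul_pos (by linarith) hℓ0
          exact_mod_cast this.trans_le hlarge
        obtain ⟨j₀, hj₀⟩ := hne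
        have : Nonempty {i : Fin ℓ // i ∉ J} := ⟨⟨j₀, by simpa using hj₀⟩⟩
        obtain ⟨g, hg⟩ := hSC.exists_range_eq
        refine ⟨g, hSC.of_range_subset hg.subset, hlarge.trans ?_⟩
        norm_cast
        refine Finset.card_le_card fun j hj => ?_
        rw [Finset.mem_filter, Finset.mem_filter, hg]
        exact ⟨Finset.mem_univ _, Finset.mem_univ _, ⟨⟨j, by simpa using hj⟩, rfl⟩⟩
      · calc (Fintype.card (Fin N → Pref A) : ℝ) * Real.exp (-(ℓ * d ^ 2 / 4))
            ≤ Real.exp (2 * L) * Real.exp (-(ℓ * d ^ 2 / 4)) := by gcongr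
          _ = Real.exp (2 * L - ℓ * d ^ 2 / 4) := by rw [← Real.exp_add, sub_eq_add_neg]
          _ ≤ Real.exp (-Real.log (1 / δ)) := Real.exp_le_exp.2 (by linarith)
          _ = δ := hδexp
    linarith [pr_add_pr_not (fun σ : Fin ℓ → Fin n => f (fun j => P (σ j)) = false)]
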